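/- arXiv:1802.03946 — 3 statements merged into one kernel-verified Lean document; each statement's English description precedes it below -/
import Mathlib

section
/- Let μ be a finite Borel measure on ℝ with positive Fourier dimension, and let (a_n)_{n∈ℕ} be a sequence of real numbers such that for some constant c > 0 one has |a_k − a_j| ≥ c for all k, j ∈ ℕ with k ≠ j. Then for μ-almost all x ∈ ℝ, the sequence (a_n · x)_{n∈ℕ} is uniformly distributed modulo 1. -/
open MeasureTheory Filter

/-- A finite Borel measure on `ℝ` has positive Fourier dimension if its Fourier
transform `μ̂(t) = ∫ e^{-2πixt} dμ(x)` satisfies `|μ̂(t)| ≤ C (1+|t|)^{-η/2}`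
for some `η > 0`, `C > 0`. -/
def HasPosFourierDim (μ : Measure ℝ) : Prop :=
  ∃ η : ℝ, 0 < η ∧ ∃ C : ℝ, 0 < C ∧ ∀ t : ℝ,
    ‖∫ x : ℝ, Complex.exp (-(2 * (Real.pi : ℂ) * Complex.I * (x : ℂ) * (t : ℂ))) ∂μ‖
      ≤ C * (1 + |t|) ^ (-(η / 2))

/-- **Weyl's criterion** for probability measures on the circle: if all nontrivial Fourier
coefficients tend to zero, then the measures converge weakly to Haar measure. -/
theorem tendsto_haarAddCircle_of_tendsto_fourier {ι : Type*} {L : Filter ι}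
    (ν : ι → ProbabilityMeasure (AddCircle (1 : ℝ))) {ν₀ : ProbabilityMeasure (AddCircle (1 : ℝ))}
    (hν₀ : (ν₀ : Measure (AddCircle (1 : ℝ))) = AddCircle.haarAddCircle)
    (h : ∀ m : ℤ, m ≠ 0 → Tendsto (fun i => ∫ y, fourier m y ∂(ν i : Measure (AddCircle (1 : ℝ))))
      L (nhds 0)) :
    Tendsto ν L (nhds ν₀) := by
  have hint (f : C(AddCircle (1 : ℝ), ℂ)) (μ : Measure (AddCircle (1 : ℝ)))
      [IsProbabilityMeasure μ] : Integrable f μ :=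
    f.continuous.integrable_of_hasCompactSupport (HasCompactSupport.of_compactSpace f)
  have hspan : ∀ g ∈ Submodule.span ℂ (Set.range (fourier (T := (1 : ℝ)))),
      Tendsto (fun i => ∫ y, g y ∂(ν i : Measure (AddCircle (1 : ℝ)))) L
        (nhds (∫ y, g y ∂AddCircle.haarAddCircle)) := by
    intro g hg
    induction hg using Submodule.span_induction with
    | mem g hg =>
      obtain ⟨m, rfl⟩ := hg
      by_cases hm : m = 0
      · subst hm
        simp [tendsto_const_nhds]
      · have h0 : ∫ y, fourier m y ∂(AddCircle.haarAddCircle (T := (1 : ℝ))) = 0 :=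
          integral_eq_zero_of_add_right_eq_neg (fourier_add_half_inv_index hm one_pos)
        rw [h0]
        exact h m hm
    | zero => simp [tendsto_const_nhds]
    | add f g _ _ hf hg =>
      simp only [ContinuousMap.add_apply]
      rw [integral_add (hint f _) (hint g _)]
      refine (hf.add hg).congr fun i => ?_
      rw [integral_add (hint f _) (hint g _)]
    | smul a f _ hf =>
      simp only [ContinuousMap.smul_apply]
      rw [integral_smul]
      refine (hf.const_smul a).congr fun i => ?_
      rw [integral_smul]
  rw [ProbabilityMeasure.tendsto_iff_forall_integral_rclike_tendsto ℂ, hν₀]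
  intro f
  have hf : f.toContinuousMap ∈
      (Submodule.span ℂ (Set.range (fourier (T := (1 : ℝ))))).topologicalClosure := by
    rw [span_fourier_closure_eq_top]
    trivial
  have hdist (g : C(AddCircle (1 : ℝ), ℂ)) (μ : Measure (AddCircle (1 : ℝ)))
      [IsProbabilityMeasure μ] :
      dist (∫ y, f y ∂μ) (∫ y, g y ∂μ) ≤ dist f.toContinuousMap g := by
    rw [dist_eq_norm, ← integral_sub (f := f) (hint f.toContinuousMap μ) (hint g μ)]
    refine (norm_integral_le_of_norm_le_const (C := dist f.toContinuousMap g)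
      (.of_forall fun y => ?_)).trans (by simp)
    rw [← dist_eq_norm]
    exact ContinuousMap.dist_apply_le_dist y
  rw [Metric.tendsto_nhds]
  intro ε hε
  obtain ⟨g, hg, hfg⟩ := Metric.mem_closure_iff.1 hf (ε / 3) (by positivity)
  filter_upwards [Metric.tendsto_nhds.1 (hspan g hg) (ε / 3) (by positivity)] with i hi
  have h1 := hdist g (ν i : Measure (AddCircle (1 : ℝ)))
  have h2 := hdist g AddCircle.haarAddCircle
  have h3 := dist_triangle4 (∫ y, f y ∂(ν i : Measure (AddCircle (1 : ℝ))))
    (∫ y, g y ∂(ν i : Measure (AddCircle (1 : ℝ)))) (∫ y, g y ∂AddCircle.haarAddCircle)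
    (∫ y, f y ∂AddCircle.haarAddCircle)
  rw [dist_comm (∫ y, g y ∂AddCircle.haarAddCircle)] at h3
  linarith

theorem frontier_image_Ico_addCircle_subset (p b₁ b₂ : ℝ) :
    frontier ((↑) '' Set.Ico b₁ b₂ : Set (AddCircle p)) ⊆ {(b₁ : AddCircle p), (b₂ : AddCircle p)} := by
  intro y hy
  have hcont : Continuous ((↑) : ℝ → AddCircle p) := AddCircle.continuous_mk' p
  have hclosed : IsClosed ((↑) '' Set.Icc b₁ b₂ : Set (AddCircle p)) :=
    (isCompact_Icc.image hcont).isClosed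
  have hopen : IsOpen ((↑) '' Set.Ioo b₁ b₂ : Set (AddCircle p)) :=
    QuotientAddGroup.isOpenMap_coe _ isOpen_Ioo
  obtain ⟨t, ht, rfl⟩ := closure_minimal (Set.image_mono Set.Ico_subset_Icc_self) hclosed hy.1
  have hnot : t ∉ Set.Ioo b₁ b₂ := fun h =>
    hy.2 (interior_maximal (Set.image_mono Set.Ioo_subset_Ico_self) hopen ⟨t, h, rfl⟩)
  rcases ht.1.eq_or_lt with h | h
  · simp [h]
  · rcases ht.2.eq_or_lt with h' | h'
    · simp [h']
    · exact absurd ⟨h, h'⟩ hnot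

theorem coe_mem_image_Ico_addCircle_iff {b₁ b₂ : ℝ} (h₁ : 0 ≤ b₁) (h₂ : b₂ ≤ 1) (x : ℝ) :
    (x : AddCircle (1 : ℝ)) ∈ ((↑) '' Set.Ico b₁ b₂ : Set (AddCircle (1 : ℝ))) ↔
      Int.fract x ∈ Set.Ico b₁ b₂ := by
  constructor
  · rintro ⟨t, ht, htx⟩
    rw [← AddCircle.coe_fract x, AddCircle.coe_eq_coe_iff_of_mem_Ico (a := 0)
      ⟨h₁.trans ht.1, by linarith [ht.2]⟩
      ⟨Int.fract_nonneg x, by simpa using Int.fract_lt_one x⟩] at htx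
    rwa [← htx]
  · intro h
    exact ⟨_, h, AddCircle.coe_fract x⟩

theorem measurableSet_image_Ico_addCircle (p b₁ b₂ : ℝ) :
    MeasurableSet ((↑) '' Set.Ico b₁ b₂ : Set (AddCircle p)) := by
  rcases lt_or_ge b₁ b₂ with hb | hb
  · have hopen : IsOpen ((↑) '' Set.Ioo b₁ b₂ : Set (AddCircle p)) :=
      QuotientAddGroup.isOpenMap_coe _ isOpen_Ioo
    rw [← Set.Ioo_insert_left hb, Set.image_insert_eq]
    exact hopen.measurableSet.insert _
  · simp [Set.Ico_eq_empty (not_lt.2 hb)]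

theorem haarAddCircle_singleton (y : AddCircle (1 : ℝ)) :
    AddCircle.haarAddCircle ({y} : Set (AddCircle (1 : ℝ))) = 0 := by
  have hvol := AddCircle.volume_eq_smul_haarAddCircle (T := (1 : ℝ))
  rw [ENNReal.ofReal_one, one_smul] at hvol
  rw [← hvol, ← Metric.closedBall_zero, AddCircle.volume_closedBall]
  simp

theorem haarAddCircle_image_Ico {b₁ b₂ : ℝ} (h₁ : 0 ≤ b₁) (h₂ : b₂ ≤ 1) :
    AddCircle.haarAddCircle ((↑) '' Set.Ico b₁ b₂ : Set (AddCircle (1 : ℝ))) =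
      ENNReal.ofReal (b₂ - b₁) := by
  have hvol := AddCircle.volume_eq_smul_haarAddCircle (T := (1 : ℝ))
  rw [ENNReal.ofReal_one, one_smul] at hvol
  rw [← hvol, AddCircle.add_projection_respects_measure 1 0
    (measurableSet_image_Ico_addCircle 1 b₁ b₂), zero_add, ← Real.volume_Ico,
    measure_congr ((ae_eq_refl _).inter Ico_ae_eq_Ioc.symm)]
  congr 1
  ext x
  rw [Set.mem_inter_iff, Set.mem_preimage, coe_mem_image_Ico_addCircle_iff h₁ h₂]
  constructor
  · rintro ⟨hx, hx'⟩
    rwa [Int.fract_eq_self.2 hx'] at hx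
  · intro hx
    have hx' : x ∈ Set.Ico (0 : ℝ) 1 := ⟨h₁.trans hx.1, hx.2.trans_le h₂⟩
    rw [Int.fract_eq_self.2 hx']
    exact ⟨hx, hx'⟩

/-- **Weyl's criterion** along a sequence `N` of lengths. -/
theorem tendsto_card_fract_div_of_tendsto_fourier (b : ℕ → ℝ) {ι : Type*} {L : Filter ι} (N : ι → ℕ)
    (hN : ∀ n, N n ≠ 0)
    (h : ∀ m : ℤ, m ≠ 0 → Tendsto
      (fun n => (∑ k ∈ Finset.Icc 1 (N n), fourier m (b k : AddCircle (1 : ℝ))) / (N n : ℂ))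
      L (nhds 0))
    {b₁ b₂ : ℝ} (h₁ : 0 ≤ b₁) (hb : b₁ < b₂) (h₂ : b₂ ≤ 1) :
    Tendsto (fun n => (((Finset.Icc 1 (N n)).filter
            (fun k => b₁ ≤ Int.fract (b k) ∧ Int.fract (b k) < b₂)).card : ℝ) / (N n : ℝ))
        L (nhds (b₂ - b₁)) := by
  let ρ (n : ι) : Measure (AddCircle (1 : ℝ)) :=
    (N n : ENNReal)⁻¹ • ∑ k ∈ Finset.Icc 1 (N n), Measure.dirac (b k : AddCircle (1 : ℝ))
  have hρ (n : ι) : IsProbabilityMeasure (ρ n) := by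
    constructor
    simp [ρ, ENNReal.inv_mul_cancel (Nat.cast_ne_zero.2 (hN n))]
  obtain ⟨ν₀, hν₀⟩ : ∃ ν₀ : ProbabilityMeasure (AddCircle (1 : ℝ)),
      (ν₀ : Measure (AddCircle (1 : ℝ))) = AddCircle.haarAddCircle :=
    ⟨⟨AddCircle.haarAddCircle, inferInstance⟩, rfl⟩
  have hweak := tendsto_haarAddCircle_of_tendsto_fourier (L := L) (fun n => ⟨ρ n, hρ n⟩) hν₀ (by
    intro m hm
    refine (h m hm).congr fun n => ?_
    simp only [ProbabilityMeasure.coe_mk, ρ]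
    rw [integral_smul_measure, integral_finsetSum_measure]
    · simp [div_eq_inv_mul]
    · intro k _
      exact (fourier m).continuous.integrable_of_hasCompactSupport
        (HasCompactSupport.of_compactSpace _))
  have hE := ProbabilityMeasure.tendsto_measure_of_null_frontier_of_tendsto' hweak
    (E := (↑) '' Set.Ico b₁ b₂) (by
      rw [hν₀]
      refine measure_mono_null (frontier_image_Ico_addCircle_subset 1 b₁ b₂) ?_
      rw [Set.insert_eq, measure_union_null_iff]
      exact ⟨haarAddCircle_singleton _, haarAddCircle_singleton _⟩)
  have hE' := (ENNReal.tendsto_toReal (measure_ne_top _ _)).comp hE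
  simp only [ProbabilityMeasure.coe_mk, hν₀, haarAddCircle_image_Ico h₁ h₂] at hE'
  rw [ENNReal.toReal_ofReal (sub_nonneg.2 hb.le)] at hE'
  refine hE'.congr fun n => ?_
  have hind (k : ℕ) : Measure.dirac (b k : AddCircle (1 : ℝ)) ((↑) '' Set.Ico b₁ b₂) =
      if b₁ ≤ Int.fract (b k) ∧ Int.fract (b k) < b₂ then 1 else 0 := by
    classical
    rw [Measure.dirac_apply' _ (measurableSet_image_Ico_addCircle 1 b₁ b₂), Set.indicator_apply]
    simp only [coe_mem_image_Ico_addCircle_iff h₁ h₂, Set.mem_Ico, Pi.one_apply]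
  simp only [Function.comp_apply, ρ, Measure.smul_apply, Measure.finsetSum_apply, hind,
    Finset.sum_boole]
  simp [div_eq_inv_mul]

theorem card_filter_abs_sub_le_of_separated {ι : Type*} (s : Finset ι) (a : ι → ℝ) {c : ℝ}
    (hc : 0 < c) (hsep : ∀ k j, k ≠ j → c ≤ |a k - a j|) (y : ℝ) (M : ℕ) :
    (s.filter (fun j => |y - a j| ≤ c * M)).card ≤ 2 * M + 1 := by
  have hcard : (Finset.Icc (-(M : ℤ)) M).card = 2 * M + 1 := by
    rw [Int.card_Icc]
    lia
  rw [← hcard]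
  refine Finset.card_le_card_of_injOn (fun j => ⌊(a j - y) / c⌋) ?_ ?_
  · intro j hj
    have hj' := abs_le.1 (Finset.mem_filter.1 hj).2
    simp only [Finset.coe_Icc, Set.mem_Icc]
    constructor
    · rw [Int.le_floor, le_div_iff₀ hc]
      push_cast
      linarith [hj'.2]
    · have : ((⌊(a j - y) / c⌋ : ℤ) : ℝ) ≤ (M : ℤ) := by
        refine (Int.floor_le _).trans ?_
        rw [div_le_iff₀ hc]
        push_cast
        linarith [hj'.1]
      exact_mod_cast this
  · intro j _ k _ hjk
    by_contra hne
    have h := Int.abs_sub_lt_one_of_floor_eq_floor hjk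
    rw [← sub_div, abs_div, abs_of_pos hc, div_lt_one hc, sub_sub_sub_cancel_right] at h
    exact absurd (hsep j k hne) (not_le.2 h)

theorem sum_one_add_abs_rpow_le_of_separated (a : ℕ → ℝ) {c : ℝ} (hc : 0 < c)
    (hsep : ∀ k j, k ≠ j → c ≤ |a k - a j|) {p : ℝ} (hp : 0 < p) (y : ℝ) {N : ℕ} (hN : N ≠ 0) :
    ∑ j ∈ Finset.Icc 1 N, (1 + |y - a j|) ^ (-p) ≤
      N * (3 * (N : ℝ) ^ (-(1 / 2) : ℝ) + (min 1 c) ^ (-p) * (N : ℝ) ^ (-(p / 2))) := by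
  have hN0 : (0 : ℝ) < N := by positivity
  have hκ : 0 < min 1 c := lt_min one_pos hc
  set M := Nat.sqrt N with hM
  have hM1 : (M : ℝ) ≤ (N : ℝ) ^ (1 / 2 : ℝ) := by
    rw [← Real.sqrt_eq_rpow]
    exact Real.nat_sqrt_le_real_sqrt
  have hM2 : (N : ℝ) ^ (1 / 2 : ℝ) ≤ 1 + M := by
    rw [← Real.sqrt_eq_rpow, add_comm]
    exact Real.real_sqrt_le_nat_sqrt_succ
  have h1 : (1 : ℝ) ≤ (N : ℝ) ^ (1 / 2 : ℝ) :=
    Real.one_le_rpow (by exact_mod_cast Nat.one_le_iff_ne_zero.2 hN) (by norm_num)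
  have hterm (j : ℕ) : (1 + |y - a j|) ^ (-p) ≤ (if |y - a j| ≤ c * M then 1 else 0) +
      (min 1 c) ^ (-p) * (N : ℝ) ^ (-(p / 2)) := by
    split_ifs with h
    · have := Real.rpow_le_one_of_one_le_of_nonpos (x := 1 + |y - a j|) (z := -p)
        (by linarith [abs_nonneg (y - a j)]) (by linarith)
      have : 0 ≤ (min 1 c) ^ (-p) * (N : ℝ) ^ (-(p / 2)) := by positivity
      linarith
    · have hle : min 1 c * (N : ℝ) ^ (1 / 2 : ℝ) ≤ 1 + |y - a j| := calc
        _ ≤ min 1 c * (1 + M) := by gcongr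
        _ = min 1 c * 1 + min 1 c * M := by ring
        _ ≤ 1 * 1 + c * M := by
          gcongr
          · exact min_le_left _ _
          · exact min_le_right _ _
        _ ≤ _ := by linarith
      rw [zero_add]
      refine (Real.rpow_le_rpow_of_nonpos (by positivity) hle (by linarith)).trans_eq ?_
      rw [Real.mul_rpow hκ.le (by positivity), ← Real.rpow_mul hN0.le]
      congr 2
      ring
  refine (Finset.sum_le_sum fun j _ => hterm j).trans ?_
  rw [Finset.sum_add_distrib, Finset.sum_boole, Finset.sum_const, Nat.card_Icc, nsmul_eq_mul,
    Nat.add_sub_cancel, mul_add]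
  have hcard : (((Finset.Icc 1 N).filter (fun j => |y - a j| ≤ c * M)).card : ℝ) ≤ 2 * M + 1 := by
    exact_mod_cast card_filter_abs_sub_le_of_separated (Finset.Icc 1 N) a hc hsep y M
  have hpow : (N : ℝ) * (N : ℝ) ^ (-(1 / 2) : ℝ) = (N : ℝ) ^ (1 / 2 : ℝ) := by
    rw [← Real.rpow_one_add' hN0.le (by norm_num)]
    norm_num
  gcongr
  linarith

theorem norm_sum_sq_eq_double_sum {ι : Type*} (s : Finset ι) (z : ι → ℂ) :
    ((‖∑ k ∈ s, z k‖ ^ 2 : ℝ) : ℂ) = ∑ k ∈ s, ∑ j ∈ s, (starRingEnd ℂ) (z k) * z j := by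
  rw [Complex.ofReal_pow, ← Complex.conj_mul', map_sum, Finset.sum_mul_sum]

theorem integral_norm_sum_fourier_sq_le (μ : Measure ℝ) [IsFiniteMeasure μ] {p C : ℝ}
    (hp : 0 < p) (hC : 0 < C)
    (hμ : ∀ t : ℝ,
      ‖∫ x : ℝ, Complex.exp (-(2 * (Real.pi : ℂ) * Complex.I * (x : ℂ) * (t : ℂ))) ∂μ‖
        ≤ C * (1 + |t|) ^ (-p))
    (a : ℕ → ℝ) {c : ℝ} (hc : 0 < c) (hsep : ∀ k j : ℕ, k ≠ j → c ≤ |a k - a j|)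
    {m : ℤ} (hm : m ≠ 0) {N : ℕ} (hN : N ≠ 0) :
    ∫ x, ‖(∑ k ∈ Finset.Icc 1 N, fourier m ((a k * x : ℝ) : AddCircle (1 : ℝ))) / (N : ℂ)‖ ^ 2 ∂μ ≤
      C * (3 * (N : ℝ) ^ (-(1 / 2) : ℝ) + (min 1 (|(m : ℝ)| * c)) ^ (-p) * (N : ℝ) ^ (-(p / 2))) := by
  have hN0 : (0 : ℝ) < N := by positivity
  have hm0 : 0 < |(m : ℝ)| := by positivity
  have hsep' : ∀ k j : ℕ, k ≠ j → |(m : ℝ)| * c ≤ |m * a k - m * a j| := by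
    intro k j hkj
    rw [← mul_sub, abs_mul]
    gcongr
    exact hsep k j hkj
  have hprod (k j : ℕ) (x : ℝ) :
      (starRingEnd ℂ) (fourier m ((a k * x : ℝ) : AddCircle (1 : ℝ))) *
        fourier m ((a j * x : ℝ) : AddCircle (1 : ℝ)) =
      Complex.exp (-(2 * (Real.pi : ℂ) * Complex.I * (x : ℂ) * ((m * a k - m * a j : ℝ) : ℂ))) := by
    rw [fourier_coe_apply, fourier_coe_apply, ← Complex.exp_conj, ← Complex.exp_add]
    congr 1
    have h2 : (starRingEnd ℂ) 2 = 2 := Complex.conj_ofNat 2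
    simp [h2]
    ring
  have hint (t : ℝ) : Integrable
      (fun x : ℝ => Complex.exp (-(2 * (Real.pi : ℂ) * Complex.I * (x : ℂ) * (t : ℂ)))) μ := by
    refine Integrable.of_bound (by fun_prop) 1 (.of_forall fun x => ?_)
    rw [Complex.norm_exp]
    simp
  have hsum : ∫ x, ‖∑ k ∈ Finset.Icc 1 N, fourier m ((a k * x : ℝ) : AddCircle (1 : ℝ))‖ ^ 2 ∂μ ≤
      ∑ k ∈ Finset.Icc 1 N, ∑ j ∈ Finset.Icc 1 N, C * (1 + |m * a k - m * a j|) ^ (-p) := by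
    refine (le_abs_self _).trans ?_
    rw [← Real.norm_eq_abs, ← Complex.norm_real, ← integral_complex_ofReal]
    simp only [norm_sum_sq_eq_double_sum, hprod]
    rw [integral_finsetSum _ fun k _ => integrable_finsetSum _ fun j _ => hint _]
    refine norm_sum_le_of_le _ fun k _ => ?_
    rw [integral_finsetSum _ fun j _ => hint _]
    exact norm_sum_le_of_le _ fun j _ => hμ _
  simp only [norm_div, div_pow, Complex.norm_natCast]
  rw [integral_div, div_le_iff₀ (by positivity)]
  refine hsum.trans ?_
  simp only [← Finset.mul_sum]
  rw [mul_assoc]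
  gcongr
  refine (Finset.sum_le_sum fun k _ => sum_one_add_abs_rpow_le_of_separated (fun j => m * a j)
    (by positivity) hsep' hp (m * a k) hN).trans_eq ?_
  rw [Finset.sum_const, Nat.card_Icc, nsmul_eq_mul, Nat.add_sub_cancel]
  ring

theorem ae_tendsto_zero_of_integral_le_summable {α : Type*} [MeasurableSpace α] {μ : Measure α}
    {f : ℕ → α → ℝ} (hf : ∀ n, Integrable (f n) μ) (hf0 : ∀ n x, 0 ≤ f n x) {g : ℕ → ℝ}
    (hg : Summable g) (hfg : ∀ n, ∫ x, f n x ∂μ ≤ g n) :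
    ∀ᵐ x ∂μ, Tendsto (fun n => f n x) atTop (nhds 0) := by
  have hmeas (n : ℕ) : AEMeasurable (fun x => ENNReal.ofReal (f n x)) μ :=
    (hf n).aestronglyMeasurable.aemeasurable.ennreal_ofReal
  have hlt : ∫⁻ x, ∑' n, ENNReal.ofReal (f n x) ∂μ ≠ ⊤ := by
    rw [lintegral_tsum hmeas]
    refine ne_top_of_le_ne_top hg.tsum_ofReal_ne_top (ENNReal.tsum_le_tsum fun n => ?_)
    rw [← ofReal_integral_eq_lintegral_ofReal (hf n) (.of_forall (hf0 n))]
    exact ENNReal.ofReal_le_ofReal (hfg n)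
  filter_upwards [ae_lt_top' (AEMeasurable.tsum hmeas) hlt] with x hx
  have h := (ENNReal.tendsto_toReal ENNReal.zero_ne_top).comp
    (ENNReal.tendsto_atTop_zero_of_tsum_ne_top hx.ne)
  refine h.congr fun n => ?_
  simp [ENNReal.toReal_ofReal (hf0 n x)]

theorem summable_floor_pow_rpow_neg {r p : ℝ} (hr : 1 < r) (hp : 0 < p) :
    Summable (fun n : ℕ => (⌊r ^ n⌋₊ : ℝ) ^ (-p)) := by
  have hr0 : 0 < r := one_pos.trans hr
  have hd : 0 < 1 - r⁻¹ := sub_pos.2 (inv_lt_one_of_one_lt₀ hr)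
  have hgeom : Summable (fun n : ℕ => (1 - r⁻¹) ^ (-p) * (r ^ (-p)) ^ n) :=
    (summable_geometric_of_lt_one (by positivity)
      (Real.rpow_lt_one_of_one_lt_of_neg hr (by linarith))).mul_left _
  refine Summable.of_nonneg_of_le (fun n => by positivity) (fun n => ?_) hgeom
  refine (Real.rpow_le_rpow_of_nonpos (by positivity) (mul_pow_le_nat_floor_pow hr n)
    (by linarith)).trans_eq ?_
  rw [Real.mul_rpow hd.le (by positivity), Real.rpow_pow_comm hr0.le]

theorem ae_tendsto_fourier_average_floor_pow (μ : Measure ℝ) [IsFiniteMeasure μ] {p C : ℝ}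
    (hp : 0 < p) (hC : 0 < C)
    (hμ : ∀ t : ℝ,
      ‖∫ x : ℝ, Complex.exp (-(2 * (Real.pi : ℂ) * Complex.I * (x : ℂ) * (t : ℂ))) ∂μ‖
        ≤ C * (1 + |t|) ^ (-p))
    (a : ℕ → ℝ) {c : ℝ} (hc : 0 < c) (hsep : ∀ k j : ℕ, k ≠ j → c ≤ |a k - a j|)
    {m : ℤ} (hm : m ≠ 0) {r : ℝ} (hr : 1 < r) :
    ∀ᵐ x ∂μ, Tendsto (fun n : ℕ => (∑ k ∈ Finset.Icc 1 ⌊r ^ n⌋₊,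
      fourier m ((a k * x : ℝ) : AddCircle (1 : ℝ))) / (⌊r ^ n⌋₊ : ℂ)) atTop (nhds 0) := by
  have hsummable : Summable (fun n : ℕ => C * (3 * (⌊r ^ n⌋₊ : ℝ) ^ (-(1 / 2) : ℝ) +
      (min 1 (|(m : ℝ)| * c)) ^ (-p) * (⌊r ^ n⌋₊ : ℝ) ^ (-(p / 2)))) :=
    (((summable_floor_pow_rpow_neg hr (by norm_num)).mul_left _).add
      ((summable_floor_pow_rpow_neg hr (by positivity)).mul_left _)).mul_left _
  have hpos (n : ℕ) : ⌊r ^ n⌋₊ ≠ 0 := (Nat.floor_pos.2 (one_le_pow₀ hr.le)).ne'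
  have hbound (N : ℕ) (x : ℝ) :
      ‖(∑ k ∈ Finset.Icc 1 N, fourier m ((a k * x : ℝ) : AddCircle (1 : ℝ))) / (N : ℂ)‖ ≤ 1 := by
    rw [norm_div, Complex.norm_natCast]
    refine div_le_one_of_le₀ ((norm_sum_le _ _).trans_eq ?_) (Nat.cast_nonneg _)
    simp only [fourier_apply, Circle.norm_coe, Finset.sum_const, Nat.card_Icc, nsmul_eq_mul, mul_one,
      Nat.add_sub_cancel]
  have hcont (N : ℕ) : Continuous (fun x : ℝ =>
      (∑ k ∈ Finset.Icc 1 N, fourier m ((a k * x : ℝ) : AddCircle (1 : ℝ))) / (N : ℂ)) := by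
    simp only [fourier_coe_apply]
    fun_prop
  have hint (N : ℕ) : Integrable (fun x : ℝ =>
      ‖(∑ k ∈ Finset.Icc 1 N, fourier m ((a k * x : ℝ) : AddCircle (1 : ℝ))) / (N : ℂ)‖ ^ 2) μ := by
    refine Integrable.of_bound ((hcont N).norm.pow 2).aestronglyMeasurable 1 (.of_forall fun x => ?_)
    rw [norm_pow, norm_norm]
    exact pow_le_one₀ (norm_nonneg _) (hbound N x)
  filter_upwards [ae_tendsto_zero_of_integral_le_summable (fun n => hint ⌊r ^ n⌋₊)
    (fun n x => by positivity) hsummable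
    (fun n => integral_norm_sum_fourier_sq_le μ hp hC hμ a hc hsep hm (hpos n))] with x hx
  rw [tendsto_zero_iff_norm_tendsto_zero]
  simpa only [Real.sqrt_sq (norm_nonneg _), Real.sqrt_zero] using hx.sqrt

theorem uniform_distribution_of_separated_sequence
    (μ : Measure ℝ) [IsFiniteMeasure μ] (hμ : HasPosFourierDim μ)
    (a : ℕ → ℝ) (c : ℝ) (hc : 0 < c)
    (hsep : ∀ k j : ℕ, k ≠ j → c ≤ |a k - a j|) :
    ∀ᵐ x ∂μ, ∀ b₁ b₂ : ℝ, 0 ≤ b₁ → b₁ < b₂ → b₂ ≤ 1 →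
      Tendsto (fun N : ℕ =>
          (((Finset.Icc 1 N).filter
            (fun n => b₁ ≤ Int.fract (a n * x) ∧ Int.fract (a n * x) < b₂)).card : ℝ) / (N : ℝ))
        atTop (nhds (b₂ - b₁)) := by
  obtain ⟨η, hη, C, hC, hμ⟩ := hμ
  let r (i : ℕ) : ℝ := 1 + 1 / ((i : ℝ) + 1)
  have hr (i : ℕ) : 1 < r i := lt_add_of_pos_right 1 (by positivity)
  have hr_tendsto : Tendsto r atTop (nhds 1) := by
    simpa [r] using tendsto_one_div_add_atTop_nhds_zero_nat.const_add (1 : ℝ)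
  have hae : ∀ᵐ x ∂μ, ∀ (i : ℕ) (m : ℤ), m ≠ 0 →
      Tendsto (fun n : ℕ => (∑ k ∈ Finset.Icc 1 ⌊r i ^ n⌋₊,
        fourier m ((a k * x : ℝ) : AddCircle (1 : ℝ))) / (⌊r i ^ n⌋₊ : ℂ)) atTop (nhds 0) := by
    simp only [ae_all_iff]
    exact fun i m hm =>
      ae_tendsto_fourier_average_floor_pow μ (half_pos hη) hC hμ a hc hsep hm (hr i)
  filter_upwards [hae] with x hx b₁ b₂ h₁ hb h₂
  refine tendsto_div_of_monotone_of_tendsto_div_floor_pow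
    (fun N => (((Finset.Icc 1 N).filter
      (fun n => b₁ ≤ Int.fract (a n * x) ∧ Int.fract (a n * x) < b₂)).card : ℝ))
    (b₂ - b₁) (fun M N hMN => ?_) r hr hr_tendsto fun i => ?_
  · exact Nat.cast_le.2 (Finset.card_le_card
      (Finset.filter_subset_filter _ (Finset.Icc_subset_Icc_right hMN)))
  · exact tendsto_card_fract_div_of_tendsto_fourier (fun k => a k * x) (fun n => ⌊r i ^ n⌋₊)
      (fun n => (Nat.floor_pos.2 (one_le_pow₀ (hr i).le)).ne') (hx i) h₁ hb h₂
end

section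
/- There is no nonzero finite Borel measure μ on ℝ with positive Fourier dimension whose support is contained in the middle-thirds Cantor set. Equivalently: if μ is a finite Borel measure supported on the ternary Cantor set and μ has positive Fourier dimension, then μ is the zero measure. -/
open MeasureTheory Filter

/-- The middle-thirds Cantor set: real numbers `∑ aₙ/3ⁿ` with digits `aₙ ∈ {0,2}`. -/
def ternaryCantorSet : Set ℝ :=
  {x : ℝ | ∃ a : ℕ → ℕ, (∀ n, a n = 0 ∨ a n = 2) ∧
    x = ∑' n : ℕ, (a n : ℝ) / 3 ^ (n + 1)}

open scoped Topology

theorem summable_digits_div_pow {a : ℕ → ℕ} (ha : ∀ n, a n = 0 ∨ a n = 2) :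
    Summable fun n : ℕ ↦ (a n : ℝ) / 3 ^ (n + 1) := by
  refine Summable.of_nonneg_of_le (fun n ↦ by positivity) (fun n ↦ ?_)
    (summable_geometric_of_lt_one (r := (1 / 3 : ℝ)) (by norm_num) (by norm_num))
  have h : (a n : ℝ) ≤ 3 := by rcases ha n with h | h <;> rw [h] <;> norm_num
  rw [one_div, inv_pow, pow_succ, div_le_iff₀ (by positivity), mul_comm (3 ^ n : ℝ) 3,
    mul_left_comm, inv_mul_cancel₀ (by positivity), mul_one]
  exact h

/-- Splitting off the first ternary digit of a point of the Cantor set. -/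
theorem exists_three_mul_eq_add {x : ℝ} (hx : x ∈ ternaryCantorSet) :
    ∃ d : ℕ, (d = 0 ∨ d = 2) ∧ ∃ y ∈ ternaryCantorSet, 3 * x = d + y := by
  obtain ⟨a, ha, rfl⟩ := hx
  refine ⟨a 0, ha 0, _, ⟨fun n ↦ a (n + 1), fun n ↦ ha (n + 1), rfl⟩, ?_⟩
  rw [(summable_digits_div_pow ha).tsum_eq_zero_add, mul_add, ← tsum_mul_left]
  congr 1
  · ring
  · congr 1 with n
    rw [pow_succ _ (n + 1)]
    field_simp

theorem ternaryCantorSet_subset_Icc : ternaryCantorSet ⊆ Set.Icc 0 1 := by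
  rintro x ⟨a, ha, rfl⟩
  refine ⟨tsum_nonneg fun n ↦ by positivity, ?_⟩
  have hs : HasSum (fun n : ℕ ↦ (2 / 3 : ℝ) * (1 / 3) ^ n) 1 := by
    have h := (hasSum_geometric_of_lt_one (r := (1 / 3 : ℝ)) (by norm_num) (by norm_num)).mul_left
      (2 / 3 : ℝ)
    rwa [show (2 / 3 : ℝ) * (1 - 1 / 3)⁻¹ = 1 by norm_num] at h
  refine ((summable_digits_div_pow ha).tsum_le_tsum (fun n ↦ ?_) hs.summable).trans_eq hs.tsum_eq
  have h : (a n : ℝ) ≤ 2 := by rcases ha n with h | h <;> rw [h] <;> norm_num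
  calc (a n : ℝ) / 3 ^ (n + 1) ≤ 2 / 3 ^ (n + 1) := by gcongr
    _ = 2 / 3 * (1 / 3) ^ n := by rw [one_div, inv_pow, pow_succ]; field_simp

theorem exists_mem_ternaryCantorSet_coe_eq {x : ℝ} (hx : x ∈ ternaryCantorSet) (n : ℕ) :
    ∃ y ∈ ternaryCantorSet, ((3 ^ n * x : ℝ) : UnitAddCircle) = y := by
  induction n with
  | zero => exact ⟨x, hx, by simp⟩
  | succ n ih =>
    obtain ⟨y, hy, hxy⟩ := ih
    obtain ⟨d, -, z, hz, hyz⟩ := exists_three_mul_eq_add hy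
    refine ⟨z, hz, ?_⟩
    have h3 (w : ℝ) : ((3 * w : ℝ) : UnitAddCircle) = (3 : ℕ) • (w : UnitAddCircle) := by
      rw [← AddCircle.coe_nsmul, nsmul_eq_mul, Nat.cast_ofNat]
    have hd : ((d : ℝ) : UnitAddCircle) = 0 :=
      (AddCircle.coe_eq_zero_iff 1).2 ⟨d, by simp⟩
    rw [pow_succ', mul_assoc, h3, hxy, ← h3, hyz, AddCircle.coe_add, hd, zero_add]

theorem norm_coe_le_of_mem_ternaryCantorSet {x : ℝ} (hx : x ∈ ternaryCantorSet) :
    ‖(x : UnitAddCircle)‖ ≤ 1 / 3 := by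
  obtain ⟨d, hd, y, hy, hxy⟩ := exists_three_mul_eq_add hx
  obtain ⟨hy0, hy1⟩ := ternaryCantorSet_subset_Icc hy
  have hle (w : ℝ) : ‖(w : UnitAddCircle)‖ ≤ |w| := QuotientAddGroup.norm_mk_le_norm
  rcases hd with rfl | rfl
  · refine (hle x).trans (abs_le.2 ⟨?_, ?_⟩) <;> push_cast at hxy <;> linarith
  · have h1 : ((x - 1 : ℝ) : UnitAddCircle) = x := by
      rw [AddCircle.coe_sub, AddCircle.coe_period, sub_zero]
    rw [← h1]
    refine (hle _).trans (abs_le.2 ⟨?_, ?_⟩) <;> push_cast at hxy <;> linarith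

theorem norm_coe_three_pow_mul_le {x : ℝ} (hx : x ∈ ternaryCantorSet) (n : ℕ) :
    ‖((3 ^ n * x : ℝ) : UnitAddCircle)‖ ≤ 1 / 3 := by
  obtain ⟨y, hy, h⟩ := exists_mem_ternaryCantorSet_coe_eq hx n
  exact h ▸ norm_coe_le_of_mem_ternaryCantorSet hy

theorem integral_fourier_of_ne_zero {k : ℤ} (hk : k ≠ 0) :
    ∫ y : UnitAddCircle, fourier k y ∂AddCircle.haarAddCircle = 0 :=
  integral_eq_zero_of_add_right_eq_neg (fourier_add_half_inv_index hk one_pos)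

/-- The Fourier transform of a measure of positive Fourier dimension vanishes at infinity. -/
theorem HasPosFourierDim.tendsto_zero {μ : Measure ℝ} (hμ : HasPosFourierDim μ) {ι : Type*}
    {l : Filter ι} {t : ι → ℝ} (ht : Tendsto (fun i ↦ |t i|) l atTop) :
    Tendsto (fun i ↦ ∫ x : ℝ,
      Complex.exp (-(2 * (Real.pi : ℂ) * Complex.I * (x : ℂ) * (t i : ℂ))) ∂μ) l (𝓝 0) := by
  obtain ⟨η, hη, C, -, h⟩ := hμ
  refine squeeze_zero_norm (fun i ↦ h (t i)) ?_
  simpa using ((tendsto_rpow_neg_atTop (half_pos hη)).comp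
    (tendsto_atTop_add_const_left l 1 ht)).const_mul C

theorem HasPosFourierDim.tendsto_integral_fourier {μ : Measure ℝ} [IsFiniteMeasure μ]
    (hμ : HasPosFourierDim μ) (k : ℤ) :
    Tendsto (fun n : ℕ ↦ ∫ x, fourier k ((3 ^ n * x : ℝ) : UnitAddCircle) ∂μ) atTop
      (𝓝 (μ.real Set.univ * ∫ y : UnitAddCircle, fourier k y ∂AddCircle.haarAddCircle)) := by
  rcases eq_or_ne k 0 with rfl | hk
  · simp
  · rw [integral_fourier_of_ne_zero hk, mul_zero]
    have ht : Tendsto (fun n : ℕ ↦ |-(k * 3 ^ n : ℝ)|) atTop atTop := by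
      simp only [abs_neg, abs_mul, abs_pow, Nat.abs_ofNat]
      exact (tendsto_pow_atTop_atTop_of_one_lt (by norm_num)).const_mul_atTop (by positivity)
    refine (hμ.tendsto_zero ht).congr fun n ↦ integral_congr_ae (.of_forall fun x ↦ ?_)
    simp only [fourier_coe_apply]
    congr 1
    push_cast
    ring

/-- The images of `μ` under `x ↦ 3 ^ n * x` equidistribute on the circle. -/
theorem HasPosFourierDim.tendsto_integral_continuousMap {μ : Measure ℝ} [IsFiniteMeasure μ]
    (hμ : HasPosFourierDim μ) (f : C(UnitAddCircle, ℂ)) :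
    Tendsto (fun n : ℕ ↦ ∫ x, f ((3 ^ n * x : ℝ) : UnitAddCircle) ∂μ) atTop
      (𝓝 (μ.real Set.univ * ∫ y : UnitAddCircle, f y ∂AddCircle.haarAddCircle)) := by
  have hint (g : C(UnitAddCircle, ℂ)) (n : ℕ) :
      Integrable (fun x : ℝ ↦ g ((3 ^ n * x : ℝ) : UnitAddCircle)) μ := by
    refine Integrable.of_bound (C := ‖g‖) (Continuous.aestronglyMeasurable ?_)
      (.of_forall fun x ↦ g.norm_coe_le_norm _)
    exact g.continuous.comp ((AddCircle.continuous_mk' 1).comp (continuous_const_mul _))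
  have hint' (g : C(UnitAddCircle, ℂ)) : Integrable g AddCircle.haarAddCircle :=
    g.continuous.integrable_of_hasCompactSupport (HasCompactSupport.of_compactSpace _)
  have hspan (g : C(UnitAddCircle, ℂ)) (hg : g ∈ Submodule.span ℂ (Set.range (fourier (T := 1)))) :
      Tendsto (fun n : ℕ ↦ ∫ x, g ((3 ^ n * x : ℝ) : UnitAddCircle) ∂μ) atTop
        (𝓝 (μ.real Set.univ * ∫ y : UnitAddCircle, g y ∂AddCircle.haarAddCircle)) := by
    induction hg using Submodule.span_induction with
    | mem g hg =>
      obtain ⟨k, rfl⟩ := hg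
      exact hμ.tendsto_integral_fourier k
    | zero => simp
    | add g h _ _ hg hh =>
      simp only [ContinuousMap.add_apply, integral_add (hint g _) (hint h _),
        integral_add (hint' g) (hint' h), mul_add]
      exact hg.add hh
    | smul c g _ hg =>
      simp only [ContinuousMap.smul_apply, integral_smul, mul_smul_comm]
      exact hg.const_smul c
  set M := μ.real Set.univ
  have hM : 0 ≤ M := measureReal_nonneg
  have hf : f ∈ closure (Submodule.span ℂ (Set.range (fourier (T := 1))) : Set _) := by
    rw [← Submodule.topologicalClosure_coe, span_fourier_closure_eq_top]
    trivial
  rw [Metric.tendsto_atTop]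
  intro ε hε
  obtain ⟨g, hg, hfg⟩ := Metric.mem_closure_iff.1 hf (ε / (3 * (M + 1))) (by positivity)
  obtain ⟨N, hN⟩ := Metric.tendsto_atTop.1 (hspan g hg) (ε / 3) (by positivity)
  have hsmall : ‖f - g‖ * M < ε / 3 := by
    rw [dist_eq_norm, lt_div_iff₀ (by positivity)] at hfg
    nlinarith [norm_nonneg (f - g)]
  refine ⟨N, fun n hn ↦ ?_⟩
  have h1 : dist (∫ x, f ((3 ^ n * x : ℝ) : UnitAddCircle) ∂μ)
      (∫ x, g ((3 ^ n * x : ℝ) : UnitAddCircle) ∂μ) ≤ ‖f - g‖ * M := by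
    rw [dist_eq_norm, ← integral_sub (hint f n) (hint g n)]
    exact norm_integral_le_of_norm_le_const (.of_forall fun x ↦ (f - g).norm_coe_le_norm _)
  have h2 : dist (M * ∫ y : UnitAddCircle, g y ∂AddCircle.haarAddCircle : ℂ)
      (M * ∫ y : UnitAddCircle, f y ∂AddCircle.haarAddCircle) ≤ ‖f - g‖ * M := by
    rw [dist_comm, dist_eq_norm, ← mul_sub, ← integral_sub (hint' f) (hint' g), norm_mul,
      Complex.norm_real, Real.norm_of_nonneg hM, mul_comm]
    gcongr
    simpa using norm_integral_le_of_norm_le_const (μ := AddCircle.haarAddCircle)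
      (.of_forall fun x ↦ (f - g).norm_coe_le_norm x)
  linarith [hN n hn, dist_triangle4 (∫ x, f ((3 ^ n * x : ℝ) : UnitAddCircle) ∂μ)
    (∫ x, g ((3 ^ n * x : ℝ) : UnitAddCircle) ∂μ)
    (M * ∫ y : UnitAddCircle, g y ∂AddCircle.haarAddCircle : ℂ)
    (M * ∫ y : UnitAddCircle, f y ∂AddCircle.haarAddCircle)]

theorem cantor_set_supports_no_measure_of_posFourierDim
    (μ : Measure ℝ) [IsFiniteMeasure μ]
    (hsupp : μ ternaryCantorSetᶜ = 0)
    (hμ : HasPosFourierDim μ) :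
    μ = 0 := by
  let b : UnitAddCircle → ℝ := fun y ↦ max 0 (‖y‖ - 1 / 3)
  have hb : Continuous b := by fun_prop
  have hpos : 0 < ∫ y, b y ∂AddCircle.haarAddCircle := by
    refine hb.integral_pos_of_hasCompactSupport_nonneg_nonzero
      (HasCompactSupport.of_compactSpace _) (fun y ↦ le_max_left _ _)
      (x := ((1 / 2 : ℝ) : UnitAddCircle)) ?_
    have h : ‖((1 / 2 : ℝ) : UnitAddCircle)‖ = 1 / 2 := by
      simpa using AddCircle.norm_half_period_eq (1 : ℝ)
    simp only [b, h]
    norm_num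
  have hlim := hμ.tendsto_integral_continuousMap
    ⟨fun y ↦ (b y : ℂ), Complex.continuous_ofReal.comp hb⟩
  have hzero (n : ℕ) : ∫ x, (b ((3 ^ n * x : ℝ) : UnitAddCircle) : ℂ) ∂μ = 0 := by
    refine integral_eq_zero_of_ae ?_
    filter_upwards [mem_ae_iff.2 hsupp] with x hx
    simpa [b] using norm_coe_three_pow_mul_le hx n
  simp only [ContinuousMap.coe_mk, hzero, integral_complex_ofReal] at hlim
  have h := tendsto_nhds_unique hlim tendsto_const_nhds
  rw [mul_eq_zero, Complex.ofReal_eq_zero, Complex.ofReal_eq_zero, or_iff_left hpos.ne',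
    measureReal_eq_zero_iff] at h
  exact Measure.measure_univ_eq_zero.1 h
end

section
/- Let α ≥ 2 be an integer and let μ be a finite Borel measure on ℝ with positive Fourier dimension. For μ-almost all real numbers x, the sum of the series ∑_{n=1}^∞ ⌊((n−1)!)^α · x⌋ / (n!)^α is an irrational number. -/
open MeasureTheory Filter
open scoped Nat

/-- The integrand `e^{-2πixt}` of the Fourier transform, as a function of `t` and `x`. -/
noncomputable def fourierExp (t x : ℝ) : ℂ :=
  Complex.exp (-(2 * (Real.pi : ℂ) * Complex.I * (x : ℂ) * (t : ℂ)))

theorem continuous_fourierExp (t : ℝ) : Continuous (fourierExp t) := by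
  unfold fourierExp; fun_prop

theorem norm_fourierExp (t x : ℝ) : ‖fourierExp t x‖ = 1 := by
  have : -(2 * (Real.pi : ℂ) * Complex.I * (x : ℂ) * (t : ℂ))
      = ((-(2 * Real.pi * x * t) : ℝ) : ℂ) * Complex.I := by push_cast; ring
  rw [fourierExp, this, Complex.norm_exp_ofReal_mul_I]

theorem fourierExp_mul_conj (s t x : ℝ) :
    fourierExp s x * (starRingEnd ℂ) (fourierExp t x) = fourierExp (s - t) x := by
  simp only [fourierExp]
  rw [← Complex.exp_conj, ← Complex.exp_add]
  congr 1
  simp only [map_neg, map_mul, Complex.conj_ofReal, Complex.conj_I, Complex.conj_ofNat,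
    Complex.ofReal_sub]
  ring

theorem integrable_fourierExp (μ : Measure ℝ) [IsFiniteMeasure μ] (t : ℝ) :
    Integrable (fourierExp t) μ :=
  Integrable.of_bound (continuous_fourierExp t).aestronglyMeasurable 1
    (Eventually.of_forall fun x => (norm_fourierExp t x).le)

theorem HasPosFourierDim.tendsto_integral_fourierExp {μ : Measure ℝ} (hμ : HasPosFourierDim μ)
    {s : ℕ → ℝ} (hs : Tendsto (fun n => |s n|) atTop atTop) :
    Tendsto (fun n => ∫ x, fourierExp (s n) x ∂μ) atTop (nhds 0) := by
  obtain ⟨η, hη, C, -, h⟩ := hμ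
  refine squeeze_zero_norm (fun n => h (s n)) ?_
  have h1 : Tendsto (fun n => 1 + |s n|) atTop atTop := tendsto_atTop_add_const_left _ _ hs
  simpa using ((tendsto_rpow_neg_atTop (half_pos hη)).comp h1).const_mul C

theorem tendsto_sub_of_tendsto_succ_sub {u : ℕ → ℝ}
    (hu : Tendsto (fun n => u (n + 1) - u n) atTop atTop) (j : ℕ) :
    Tendsto (fun n => u (n + (j + 1)) - u n) atTop atTop := by
  induction j with
  | zero => exact hu
  | succ j ih =>
    refine (ih.atTop_add_atTop (hu.comp (tendsto_add_atTop_nat (j + 1)))).congr fun n => ?_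
    simp only [Function.comp_apply]
    rw [show n + (j + 1 + 1) = n + (j + 1) + 1 by ring]
    ring

theorem tendsto_abs_sub_of_tendsto_succ_sub {u : ℕ → ℝ}
    (hu : Tendsto (fun n => u (n + 1) - u n) atTop atTop) {j k : ℕ} (hjk : j ≠ k) :
    Tendsto (fun n => |u (n + j) - u (n + k)|) atTop atTop := by
  wlog h : k < j generalizing j k
  · simpa only [abs_sub_comm] using this hjk.symm (by omega)
  obtain ⟨d, rfl⟩ := Nat.exists_eq_add_of_lt h
  refine tendsto_abs_atTop_atTop.comp
    (((tendsto_sub_of_tendsto_succ_sub hu d).comp (tendsto_add_atTop_nat k)).congr fun n => ?_)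
  simp only [Function.comp_apply]
  rw [show n + k + (d + 1) = n + (k + d + 1) by ring]

/-- The second moment of a block of `M` exponentials tends to its diagonal part. -/
theorem tendsto_integral_norm_sq_sum_fourierExp {μ : Measure ℝ} [IsFiniteMeasure μ]
    (hμ : HasPosFourierDim μ) {u : ℕ → ℝ}
    (hu : Tendsto (fun n => u (n + 1) - u n) atTop atTop) (M : ℕ) :
    Tendsto (fun n => ∫ x, ‖∑ j ∈ Finset.range M, fourierExp (u (n + j)) x‖ ^ 2 ∂μ) atTop
      (nhds (M * μ.real Set.univ)) := by
  have key : ∀ n, ((∫ x, ‖∑ j ∈ Finset.range M, fourierExp (u (n + j)) x‖ ^ 2 ∂μ : ℝ) : ℂ)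
      = ∑ j ∈ Finset.range M, ∑ k ∈ Finset.range M,
          ∫ x, fourierExp (u (n + j) - u (n + k)) x ∂μ := by
    intro n
    rw [← integral_complex_ofReal]
    have : ∀ x, ((‖∑ j ∈ Finset.range M, fourierExp (u (n + j)) x‖ ^ 2 : ℝ) : ℂ)
        = ∑ j ∈ Finset.range M, ∑ k ∈ Finset.range M,
          fourierExp (u (n + j) - u (n + k)) x := by
      intro x
      push_cast
      rw [← Complex.mul_conj', map_sum, Finset.sum_mul_sum]
      simp only [fourierExp_mul_conj]
    simp only [this]
    rw [integral_finsetSum _ fun j _ =>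
      integrable_finsetSum _ fun k _ => integrable_fourierExp μ _]
    exact Finset.sum_congr rfl fun j _ =>
      integral_finsetSum _ fun k _ => integrable_fourierExp μ _
  have lim : Tendsto (fun n => ∑ j ∈ Finset.range M, ∑ k ∈ Finset.range M,
      ∫ x, fourierExp (u (n + j) - u (n + k)) x ∂μ) atTop
      (nhds (∑ j ∈ Finset.range M, ∑ k ∈ Finset.range M,
        if j = k then (μ.real Set.univ : ℂ) else 0)) := by
    refine tendsto_finsetSum _ fun j _ => tendsto_finsetSum _ fun k _ => ?_
    split_ifs with h
    · subst h
      simp [fourierExp]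
    · exact hμ.tendsto_integral_fourierExp (tendsto_abs_sub_of_tendsto_succ_sub hu h)
  have e : (∑ j ∈ Finset.range M, ∑ k ∈ Finset.range M,
        if j = k then (μ.real Set.univ : ℂ) else 0) = ((M * μ.real Set.univ : ℝ) : ℂ) := by
    rw [Finset.sum_congr rfl fun j hj => by rw [Finset.sum_ite_eq, if_pos hj]]
    simp
  rw [e] at lim
  simp only [← key] at lim
  exact Complex.continuous_re.continuousAt.tendsto.comp lim

/-- For a measure of positive Fourier dimension and a sequence with gaps tending to infinity,
almost no point has all its phases eventually close to `0`. -/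
theorem HasPosFourierDim.ae_not_tendsto_fourierExp {μ : Measure ℝ} [IsFiniteMeasure μ]
    (hμ : HasPosFourierDim μ) {u : ℕ → ℝ}
    (hu : Tendsto (fun n => u (n + 1) - u n) atTop atTop) :
    ∀ᵐ x ∂μ, ¬ Tendsto (fun n => fourierExp (u n) x) atTop (nhds 1) := by
  have bound : ∀ M : ℕ, (M : ENNReal) ^ 2 * μ {x | Tendsto (fun n => fourierExp (u n) x) atTop
      (nhds 1)} ≤ M * μ Set.univ := by
    intro M
    set g : ℕ → ℝ → ENNReal := fun n x =>
      ENNReal.ofReal (‖∑ j ∈ Finset.range M, fourierExp (u (n + j)) x‖ ^ 2) with hg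
    have hcont : ∀ n, Continuous fun x => ‖∑ j ∈ Finset.range M, fourierExp (u (n + j)) x‖ ^ 2 :=
      fun n => ((continuous_finsetSum _ fun j _ => continuous_fourierExp _).norm.pow 2)
    have hmeas : ∀ n, Measurable (g n) := fun n => (hcont n).measurable.ennreal_ofReal
    have hint : ∀ n, ∫⁻ x, g n x ∂μ = ENNReal.ofReal
        (∫ x, ‖∑ j ∈ Finset.range M, fourierExp (u (n + j)) x‖ ^ 2 ∂μ) := by
      intro n
      rw [ofReal_integral_eq_lintegral_ofReal]
      · refine Integrable.of_bound (hcont n).aestronglyMeasurable ((M : ℝ) ^ 2)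
          (Eventually.of_forall fun x => ?_)
        rw [Real.norm_of_nonneg (by positivity)]
        gcongr
        refine (norm_sum_le _ _).trans ?_
        simp [norm_fourierExp]
      · exact Eventually.of_forall fun x => by positivity
    have hlim : Tendsto (fun n => ∫⁻ x, g n x ∂μ) atTop (nhds (M * μ Set.univ)) := by
      simp only [hint]
      have := ENNReal.tendsto_ofReal (tendsto_integral_norm_sq_sum_fourierExp hμ hu M)
      rwa [ENNReal.ofReal_mul (by positivity), ENNReal.ofReal_natCast, ofReal_measureReal] at this
    calc (M : ENNReal) ^ 2 * μ {x | Tendsto (fun n => fourierExp (u n) x) atTop (nhds 1)}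
        ≤ (M : ENNReal) ^ 2 * μ {x | (M : ENNReal) ^ 2 ≤ liminf (fun n => g n x) atTop} := by
          gcongr with x
          intro hx
          have h1 : Tendsto (fun n => ∑ j ∈ Finset.range M, fourierExp (u (n + j)) x) atTop
              (nhds (∑ j ∈ Finset.range M, 1)) :=
            tendsto_finsetSum _ fun j _ => hx.comp (tendsto_add_atTop_nat j)
          have h2 := ENNReal.tendsto_ofReal (h1.norm.pow 2)
          refine le_of_eq (Eq.trans ?_ h2.liminf_eq.symm)
          simp
      _ ≤ ∫⁻ x, liminf (fun n => g n x) atTop ∂μ :=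
          mul_meas_ge_le_lintegral (Measurable.liminf hmeas) _
      _ ≤ liminf (fun n => ∫⁻ x, g n x ∂μ) atTop := lintegral_liminf_le hmeas
      _ = M * μ Set.univ := hlim.liminf_eq
  rw [ae_iff]
  simp only [not_not]
  by_contra hne
  obtain ⟨M, hM⟩ := ENNReal.exists_nat_mul_gt hne (measure_ne_top μ Set.univ)
  have hM0 : (M : ENNReal) ≠ 0 := by
    rintro h
    simp [h] at hM
  refine absurd (bound M) (not_le.2 ?_)
  rw [pow_two, mul_assoc]
  exact (ENNReal.mul_lt_mul_iff_right hM0 (ENNReal.natCast_ne_top M)).2 hM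

theorem fourierExp_eq_of_sub_eq_int {a b : ℝ} {m : ℤ} (h : a - b = m) :
    fourierExp a 1 = fourierExp b 1 := by
  rw [fourierExp, fourierExp, Complex.exp_eq_exp_iff_exists_int]
  refine ⟨-m, ?_⟩
  have : (a : ℂ) = b + m := by
    rw [← sub_eq_iff_eq_add']
    exact_mod_cast h
  rw [this]
  push_cast
  ring

theorem summable_one_div_add_one_pow {α : ℕ} (hα : 2 ≤ α) :
    Summable fun n : ℕ => 1 / ((n : ℝ) + 1) ^ α := by
  simpa using (summable_nat_add_iff 1).2 (Real.summable_one_div_nat_pow.2 (by omega : 1 < α))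

/-- The tail `∑_{n > N} n^{-α}` of the zeta series. -/
noncomputable def zetaTail (α N : ℕ) : ℝ := ∑' n : ℕ, 1 / (((n + N : ℕ) : ℝ) + 1) ^ α

theorem zetaTail_eq_add {α : ℕ} (hα : 2 ≤ α) (N : ℕ) :
    zetaTail α N = 1 / ((N : ℝ) + 1) ^ α + zetaTail α (N + 1) := by
  unfold zetaTail
  rw [((summable_nat_add_iff N).2 (summable_one_div_add_one_pow hα)).tsum_eq_zero_add]
  simp only [zero_add]
  congr 2
  ext n
  rw [show n + 1 + N = n + (N + 1) by ring]

theorem zetaTail_nonneg (α N : ℕ) : 0 ≤ zetaTail α N :=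
  tsum_nonneg fun n => by positivity

theorem tendsto_zetaTail (α : ℕ) : Tendsto (zetaTail α) atTop (nhds 0) :=
  tendsto_sum_nat_add fun n : ℕ => 1 / ((n : ℝ) + 1) ^ α

theorem one_div_pow_le_zetaTail {α : ℕ} (hα : 2 ≤ α) (N : ℕ) :
    1 / ((N : ℝ) + 1) ^ α ≤ zetaTail α N := by
  linarith [zetaTail_eq_add hα N, zetaTail_nonneg α (N + 1)]

theorem zetaTail_le_mul_succ {α : ℕ} (hα : 2 ≤ α) (N : ℕ) :
    zetaTail α N ≤ (1 + 2 ^ α) * zetaTail α (N + 1) := by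
  have h1 := one_div_pow_le_zetaTail hα (N + 1)
  have h2 : 1 / ((N : ℝ) + 1) ^ α ≤ 2 ^ α * (1 / (((N + 1 : ℕ) : ℝ) + 1) ^ α) := by
    rw [mul_one_div, div_le_div_iff₀ (by positivity) (by positivity), one_mul, ← mul_pow]
    gcongr
    push_cast
    linarith [(Nat.cast_nonneg N : (0 : ℝ) ≤ N)]
  have h3 := mul_le_mul_of_nonneg_left h1 (by positivity : (0 : ℝ) ≤ 2 ^ α)
  linarith [zetaTail_eq_add hα N]

theorem two_mul_factorial_pow_mul_zetaTail_le {α : ℕ} (hα : 2 ≤ α) {N : ℕ} (hN : 3 ≤ N) :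
    2 * ((N ! : ℝ) ^ α * zetaTail α N) ≤ ((N + 1)! : ℝ) ^ α * zetaTail α (N + 1) := by
  have h1 := zetaTail_le_mul_succ hα N
  have h0 := zetaTail_nonneg α (N + 1)
  have h2 : 2 * (1 + 2 ^ α) ≤ ((N : ℝ) + 1) ^ α := by
    have h4 : (4 : ℝ) ^ α ≤ ((N : ℝ) + 1) ^ α := by
      have : (3 : ℝ) ≤ N := by exact_mod_cast hN
      gcongr
      linarith
    have h5 : (2 : ℝ) ^ 2 ≤ 2 ^ α := pow_le_pow_right₀ (by norm_num) hα
    have h6 : (4 : ℝ) ^ α = 2 ^ α * 2 ^ α := by rw [← mul_pow]; norm_num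
    nlinarith
  have h3 : 2 * zetaTail α N ≤ ((N : ℝ) + 1) ^ α * zetaTail α (N + 1) := by nlinarith
  have h4 := mul_le_mul_of_nonneg_left h3 (by positivity : (0 : ℝ) ≤ (N ! : ℝ) ^ α)
  rw [Nat.factorial_succ]
  push_cast
  rw [mul_pow]
  linarith

theorem tendsto_factorial_pow_mul_zetaTail {α : ℕ} (hα : 2 ≤ α) :
    Tendsto (fun N : ℕ => (N ! : ℝ) ^ α * zetaTail α N) atTop atTop := by
  rw [← tendsto_add_atTop_iff_nat 3]
  refine tendsto_atTop_of_geom_le (c := 2) ?_ one_lt_two fun n => ?_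
  · have : 0 < zetaTail α (0 + 3) := lt_of_lt_of_le (by positivity) (one_div_pow_le_zetaTail hα _)
    positivity
  · rw [show n + 1 + 3 = n + 3 + 1 by ring]
    exact two_mul_factorial_pow_mul_zetaTail_le hα (by omega)

theorem tendsto_succ_sub_factorial_pow_mul_zetaTail {α : ℕ} (hα : 2 ≤ α) :
    Tendsto (fun N : ℕ => ((N + 1)! : ℝ) ^ α * zetaTail α (N + 1) - (N ! : ℝ) ^ α * zetaTail α N)
      atTop atTop := by
  refine tendsto_atTop_mono' _ ?_ (tendsto_factorial_pow_mul_zetaTail hα)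
  filter_upwards [eventually_ge_atTop 3] with N hN
  linarith [two_mul_factorial_pow_mul_zetaTail_le hα hN]

theorem summable_floor_factorial {α : ℕ} (hα : 2 ≤ α) (x : ℝ) :
    Summable fun n : ℕ =>
      ((⌊((n ! : ℝ)) ^ α * x⌋ : ℤ) : ℝ) / (((n + 1)! : ℕ) : ℝ) ^ α := by
  refine Summable.of_norm_bounded ((summable_one_div_add_one_pow hα).mul_left (|x| + 1)) fun n => ?_
  have h1 : (1 : ℝ) ≤ (n ! : ℝ) ^ α := one_le_pow₀ (by exact_mod_cast Nat.factorial_pos n)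
  have h2 : |((⌊((n ! : ℝ)) ^ α * x⌋ : ℤ) : ℝ)| ≤ (n ! : ℝ) ^ α * (|x| + 1) := by
    have h3 := Int.floor_le ((n ! : ℝ) ^ α * x)
    have h4 := Int.lt_floor_add_one ((n ! : ℝ) ^ α * x)
    have h5 := mul_le_mul_of_nonneg_left (le_abs_self x) (by positivity : (0 : ℝ) ≤ (n ! : ℝ) ^ α)
    have h6 := mul_le_mul_of_nonneg_left (neg_abs_le x) (by positivity : (0 : ℝ) ≤ (n ! : ℝ) ^ α)
    rw [abs_le]
    constructor <;> nlinarith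
  rw [Real.norm_eq_abs, abs_div, abs_of_nonneg (by positivity : (0 : ℝ) ≤ ((n + 1)! : ℝ) ^ α),
    Nat.factorial_succ]
  push_cast
  rw [mul_pow, mul_one_div, div_le_div_iff₀ (by positivity) (by positivity)]
  calc _ ≤ (n ! : ℝ) ^ α * (|x| + 1) * ((n : ℝ) + 1) ^ α := by gcongr
    _ = _ := by ring

/-- Up to an integer and a small error, `(N!)^α` times the perturbed zeta series is
`(N!)^α (∑_{n > N} n^{-α}) x`. -/
theorem exists_int_factorial_pow_mul_tsum {α : ℕ} (hα : 2 ≤ α) (x : ℝ) (N : ℕ) :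
    ∃ m : ℤ, |(N ! : ℝ) ^ α * zetaTail α N * x + m - (N ! : ℝ) ^ α * ∑' n : ℕ,
      ((⌊((n ! : ℝ)) ^ α * x⌋ : ℤ) : ℝ) / (((n + 1)! : ℕ) : ℝ) ^ α| ≤ zetaTail α N := by
  have hs := summable_floor_factorial hα x
  have hz := (summable_nat_add_iff N).2 (summable_one_div_add_one_pow hα)
  have hint : ∃ m : ℤ, (N ! : ℝ) ^ α * ∑ n ∈ Finset.range N,
      ((⌊((n ! : ℝ)) ^ α * x⌋ : ℤ) : ℝ) / (((n + 1)! : ℕ) : ℝ) ^ α = m := by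
    have : ∀ n ∈ Finset.range N, (N ! : ℝ) ^ α *
        (((⌊((n ! : ℝ)) ^ α * x⌋ : ℤ) : ℝ) / (((n + 1)! : ℕ) : ℝ) ^ α)
        = ((⌊((n ! : ℝ)) ^ α * x⌋ * ((N ! / (n + 1)! : ℕ) : ℤ) ^ α : ℤ) : ℝ) := by
      intro n hn
      have hd : (n + 1)! ∣ N ! := Nat.factorial_dvd_factorial (by simpa using hn)
      rw [Int.cast_mul, Int.cast_pow, Int.cast_natCast, Nat.cast_div hd (by positivity), div_pow]
      ring
    rw [Finset.mul_sum, Finset.sum_congr rfl this, ← Int.cast_sum]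
    exact ⟨_, rfl⟩
  obtain ⟨m, hm⟩ := hint
  refine ⟨m, ?_⟩
  rw [← hs.sum_add_tsum_nat_add N, mul_add, hm, ← tsum_mul_left, zetaTail, mul_right_comm,
    ← tsum_mul_left, add_comm, add_sub_add_left_eq_sub,
    ← (hz.mul_left _).tsum_sub (((summable_nat_add_iff N).2 hs).mul_left _), ← Real.norm_eq_abs]
  refine tsum_of_norm_bounded hz.hasSum fun n => ?_
  have hfact : (((n + N + 1)! : ℕ) : ℝ) ^ α
      = (((n + N : ℕ) : ℝ) + 1) ^ α * ((n + N)! : ℝ) ^ α := by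
    rw [Nat.factorial_succ, ← mul_pow]
    push_cast
    rfl
  have hle : (N ! : ℝ) ^ α ≤ ((n + N)! : ℝ) ^ α := by
    gcongr
    exact Nat.le_add_left N n
  have hpos : (0 : ℝ) < ((n + N)! : ℝ) ^ α := by positivity
  have hpos' : (0 : ℝ) < (((n + N : ℕ) : ℝ) + 1) ^ α := by positivity
  have heq : (N ! : ℝ) ^ α * x * (1 / (((n + N : ℕ) : ℝ) + 1) ^ α) - (N ! : ℝ) ^ α *
      (((⌊((n + N)! : ℝ) ^ α * x⌋ : ℤ) : ℝ) / (((n + N + 1)! : ℕ) : ℝ) ^ α)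
      = (N ! : ℝ) ^ α / ((n + N)! : ℝ) ^ α * Int.fract (((n + N)! : ℝ) ^ α * x)
        * (1 / (((n + N : ℕ) : ℝ) + 1) ^ α) := by
    rw [hfact, Int.fract]
    field_simp
  rw [heq, Real.norm_of_nonneg (by have := Int.fract_nonneg (((n + N)! : ℝ) ^ α * x); positivity)]
  refine mul_le_of_le_one_left (by positivity) ?_
  exact mul_le_one₀ ((div_le_one hpos).2 hle) (Int.fract_nonneg _) (Int.fract_lt_one _).le

theorem perturbed_zeta_irrational
    (α : ℕ) (hα : 2 ≤ α)
    (μ : Measure ℝ) [IsFiniteMeasure μ] (hμ : HasPosFourierDim μ) :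
    ∀ᵐ x ∂μ, Irrational (∑' n : ℕ,
      ((⌊((n ! : ℝ)) ^ α * x⌋ : ℤ) : ℝ) / (((n + 1)! : ℕ) : ℝ) ^ α) := by
  filter_upwards [hμ.ae_not_tendsto_fourierExp (u := fun N => (N ! : ℝ) ^ α * zetaTail α N)
    (tendsto_succ_sub_factorial_pow_mul_zetaTail hα)] with x hx
  rintro ⟨q, hq⟩
  refine hx ?_
  choose m hm using exists_int_factorial_pow_mul_tsum hα x
  simp only [← hq, ← Real.norm_eq_abs] at hm
  have herr := squeeze_zero_norm hm (tendsto_zetaTail α)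
  have hexp : Tendsto (fun N => fourierExp ((N ! : ℝ) ^ α * zetaTail α N * x + m N
      - (N ! : ℝ) ^ α * q) 1) atTop (nhds 1) := by
    have hc : Continuous fun t => fourierExp t 1 := by unfold fourierExp; fun_prop
    simpa [fourierExp, Function.comp_def] using (hc.tendsto 0).comp herr
  refine hexp.congr' ?_
  filter_upwards [eventually_ge_atTop q.den] with N hN
  obtain ⟨c, hc⟩ : (q.den : ℤ) ∣ (N ! : ℤ) ^ α :=
    (Int.natCast_dvd_natCast.2 (Nat.dvd_factorial q.pos hN)).trans (dvd_pow_self _ (by omega))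
  have hint : (N ! : ℝ) ^ α * q = ((c * q.num : ℤ) : ℝ) := by
    have h1 : (N ! : ℝ) ^ α = q.den * c := by exact_mod_cast hc
    have h2 : (q : ℝ) * q.den = q.num := by exact_mod_cast q.mul_den_eq_num
    push_cast
    rw [h1, ← h2]
    ring
  have : fourierExp ((N ! : ℝ) ^ α * zetaTail α N) x
      = fourierExp ((N ! : ℝ) ^ α * zetaTail α N * x) 1 := by
    simp only [fourierExp]
    push_cast
    ring_nf
  rw [this]
  refine fourierExp_eq_of_sub_eq_int (m := m N - c * q.num) ?_
  rw [hint]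
  push_cast
  ring
end
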